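/- Let Ω ⊆ ℝ^N be open and let A ⊆ Ω be a measurable set of finite perimeter in Ω. Then for every ε > 0 there exist a set Z ⊆ Ω with H^{N-1}(Z) < ε and an open set U ⊆ Ω such that U ∪ Z ⊇ A^{(1)}, λ^N(U \ A) < ε, and P(U,Ω) < P(A,Ω) + ε. Here A^{(1)} denotes the set of points x ∈ Ω where A has density 1, i.e. λ^N(A∩B_ρ(x))/λ^N(B_ρ(x)) → 1 as ρ → 0⁺. -/

import Mathlib

open MeasureTheory Metric Filter Set
open scoped ENNReal Topology symmDiff

noncomputable section

abbrev Euc (N : ℕ) : Type := EuclideanSpace ℝ (Fin N)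

variable {N : ℕ}

/-- The divergence of a vector field `φ : ℝ^N → ℝ^N`. -/
def diverg (φ : Euc N → Euc N) (x : Euc N) : ℝ :=
  ∑ i : Fin N, fderiv ℝ φ x (EuclideanSpace.single i 1) i

/-- The admissible test vector fields for the variation in `Ω`:
`C^1`, compactly supported in `Ω`, with `‖φ‖ ≤ 1`. -/
def TestVF (Ω : Set (Euc N)) : Set (Euc N → Euc N) :=
  {φ | ContDiff ℝ 1 φ ∧ HasCompactSupport φ ∧ tsupport φ ⊆ Ω ∧ ∀ x, ‖φ x‖ ≤ 1}

/-- The total variation `V(u, Ω)`. -/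
def variation (u : Euc N → ℝ) (Ω : Set (Euc N)) : ℝ≥0∞ :=
  ⨆ φ ∈ TestVF Ω, ENNReal.ofReal (∫ x in Ω, u x * diverg φ x)

/-- The perimeter `P(A, Ω)` of `A` in `Ω`. -/
def perimeter (A Ω : Set (Euc N)) : ℝ≥0∞ :=
  ⨆ φ ∈ TestVF Ω, ENNReal.ofReal (∫ x in A, diverg φ x)

/-- `u ∈ BV(Ω)`. -/
def MemBV (u : Euc N → ℝ) (Ω : Set (Euc N)) : Prop :=
  IntegrableOn u Ω volume ∧ variation u Ω < ⊤

/-- `u ∈ BV_loc(Ω)`. -/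
def MemBVloc (u : Euc N → ℝ) (Ω : Set (Euc N)) : Prop :=
  ∀ Ω' : Set (Euc N), IsOpen Ω' → IsCompact (closure Ω') → closure Ω' ⊆ Ω → MemBV u Ω'

/-- `u ∈ GBV(Ω)`: measurable, and every truncation `(-m) ∨ u ∧ m` is in `BV_loc(Ω)`. -/
def MemGBV (u : Euc N → ℝ) (Ω : Set (Euc N)) : Prop :=
  AEMeasurable u (volume.restrict Ω) ∧
    ∀ m : ℝ, 0 < m → MemBVloc (fun x => max (-m) (min (u x) m)) Ω

/-- `A` has locally finite perimeter in `Ω`. -/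
def HasLocFinPerimeter (A Ω : Set (Euc N)) : Prop :=
  ∀ Ω' : Set (Euc N), IsOpen Ω' → IsCompact (closure Ω') → closure Ω' ⊆ Ω →
    perimeter A Ω' < ⊤

/-- `A` has density `t` at `x`. -/
def HasDensity (A : Set (Euc N)) (x : Euc N) (t : ℝ) : Prop :=
  Tendsto (fun ρ : ℝ => volume (A ∩ ball x ρ) / volume (ball x ρ)) (𝓝[>] 0)
    (𝓝 (ENNReal.ofReal t))

/-- The approximate upper limit `u⁺(x)` of `u` at `x` (relative to `Ω`), with `inf ∅ = ⊤`. -/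
def approxUpper (u : Euc N → ℝ) (Ω : Set (Euc N)) (x : Euc N) : EReal :=
  sInf {t : EReal | ∃ s : ℝ, t = (s : EReal) ∧ HasDensity {y | y ∈ Ω ∧ s < u y} x 0}

/-- The approximate lower limit `u⁻(x)` of `u` at `x` (relative to `Ω`), with `sup ∅ = ⊥`. -/
def approxLower (u : Euc N → ℝ) (Ω : Set (Euc N)) (x : Euc N) : EReal :=
  sSup {t : EReal | ∃ s : ℝ, t = (s : EReal) ∧ HasDensity {y | y ∈ Ω ∧ u y < s} x 0}

/-- The approximate limit `ũ(x)` exists (i.e. `u⁺(x) = u⁻(x)`) and is `+∞`. -/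
def HasApproxLimitTop (u : Euc N → ℝ) (Ω : Set (Euc N)) (x : Euc N) : Prop :=
  approxUpper u Ω x = ⊤ ∧ approxLower u Ω x = ⊤

/-- The approximate limit `ũ(x)` exists and `|ũ(x)| = +∞`. -/
def HasInfApproxLimit (u : Euc N → ℝ) (Ω : Set (Euc N)) (x : Euc N) : Prop :=
  (approxUpper u Ω x = ⊤ ∧ approxLower u Ω x = ⊤) ∨
    (approxUpper u Ω x = ⊥ ∧ approxLower u Ω x = ⊥)

/-- `C` is `L⁰`-polar in `Ω`. -/
def L0Polar (C Ω : Set (Euc N)) : Prop :=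
  ∃ u : Euc N → ℝ, AEMeasurable u (volume.restrict Ω) ∧
    C ⊆ {x | x ∈ Ω ∧ HasInfApproxLimit u Ω x}

/-- `C` is `BV`-polar in `Ω`. -/
def BVPolar (C Ω : Set (Euc N)) : Prop :=
  ∃ u : Euc N → ℝ, MemBV u Ω ∧ C ⊆ {x | x ∈ Ω ∧ HasInfApproxLimit u Ω x}

/-- `C` is `GBV`-polar in `Ω`. -/
def GBVPolar (C Ω : Set (Euc N)) : Prop :=
  ∃ u : Euc N → ℝ, MemGBV u Ω ∧ C ⊆ {x | x ∈ Ω ∧ HasInfApproxLimit u Ω x}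

/-- The set `A^{(1)}` of points of `Ω` where `A` has density `1`. -/
def densityOne (A Ω : Set (Euc N)) : Set (Euc N) :=
  {x | x ∈ Ω ∧ HasDensity A x 1}

/-! ### Basic facts on fields -/

/-- `C^1` compactly supported vector fields. -/
structure CF (φ : Euc N → Euc N) : Prop where
  cd : ContDiff ℝ 1 φ
  cs : HasCompactSupport φ

/-- Measurable functions with values in `[0,1]`. -/
structure Adm (f : Euc N → ℝ) : Prop where
  meas : AEStronglyMeasurable f volume
  nonneg : ∀ x, 0 ≤ f x
  le_one : ∀ x, f x ≤ 1

/-- `f` has variation at most `c` in `Ω`. -/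
def VB (Ω : Set (Euc N)) (f : Euc N → ℝ) (c : ℝ) : Prop :=
  ∀ φ ∈ TestVF Ω, ∫ x, f x * diverg φ x ≤ c

theorem TestVF.cf {Ω : Set (Euc N)} {φ : Euc N → Euc N} (h : φ ∈ TestVF Ω) : CF φ :=
  ⟨h.1, h.2.1⟩

theorem CF.diff {φ : Euc N → Euc N} (h : CF φ) (x : Euc N) : DifferentiableAt ℝ φ x :=
  (h.cd.differentiable (by norm_num)) x

theorem CF.cont_div {φ : Euc N → Euc N} (h : CF φ) : Continuous (diverg φ) := by
  have h1 : Continuous (fderiv ℝ φ) := h.cd.continuous_fderiv (by norm_num)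
  unfold diverg
  refine continuous_finsetSum _ fun i _ => ?_
  have h2 : Continuous fun x => fderiv ℝ φ x (EuclideanSpace.single i 1) :=
    h1.clm_apply continuous_const
  exact (EuclideanSpace.proj i : Euc N →L[ℝ] ℝ).continuous.comp h2

theorem CF.cs_div {φ : Euc N → Euc N} (h : CF φ) : HasCompactSupport (diverg φ) := by
  refine (h.cs.fderiv ℝ).mono' ?_
  refine Function.support_subset_iff'.2 ?_ |>.trans (subset_tsupport _)
  intro x hx
  have : fderiv ℝ φ x = 0 := by simpa using hx
  simp [diverg, this]

theorem CF.bdd_div {φ : Euc N → Euc N} (h : CF φ) : ∃ C : ℝ, 0 ≤ C ∧ ∀ x, |diverg φ x| ≤ C := by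
  obtain ⟨C, hC⟩ := h.cs_div.exists_bound_of_continuous h.cont_div
  exact ⟨C, (norm_nonneg _).trans (hC 0), hC⟩

theorem Adm.abs_le {f : Euc N → ℝ} (hf : Adm f) (x : Euc N) : ‖f x‖ ≤ 1 := by
  rw [Real.norm_eq_abs, abs_of_nonneg (hf.nonneg x)]; exact hf.le_one x

theorem Adm.int_mul {f g : Euc N → ℝ} (hf : Adm f) (hg : Integrable g) :
    Integrable (fun x => f x * g x) :=
  hg.bdd_mul hf.meas (Eventually.of_forall hf.abs_le)

theorem CF.int_div {φ : Euc N → Euc N} (h : CF φ) : Integrable (diverg φ) :=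
  h.cont_div.integrable_of_hasCompactSupport h.cs_div

theorem Adm.locInt {f : Euc N → ℝ} (hf : Adm f) : LocallyIntegrable f := by
  have : LocallyIntegrable (fun _ : Euc N => (1 : ℝ)) := locallyIntegrable_const _
  exact this.mono hf.meas (Eventually.of_forall fun x => by simpa using hf.abs_le x)

theorem sum_single (v : Euc N) : ∑ i, v i • (EuclideanSpace.single i (1 : ℝ) : Euc N) = v := by
  ext j
  simp [Finset.sum_apply, Pi.single_apply]

theorem diverg_smul {u : Euc N → ℝ} {φ : Euc N → Euc N} {x : Euc N}
    (hu : DifferentiableAt ℝ u x) (hφ : DifferentiableAt ℝ φ x) :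
    diverg (fun y => u y • φ y) x = u x * diverg φ x + fderiv ℝ u x (φ x) := by
  unfold diverg
  have h1 : fderiv ℝ (fun y => u y • φ y) x = _ := fderiv_fun_smul hu hφ
  rw [h1]
  simp only [add_apply, smul_apply,
    ContinuousLinearMap.smulRight_apply, PiLp.add_apply, PiLp.smul_apply, smul_eq_mul,
    Finset.sum_add_distrib, Finset.mul_sum]
  congr 1
  conv_rhs => rw [← sum_single (φ x), map_sum]
  refine Finset.sum_congr rfl fun i _ => ?_
  rw [map_smul, smul_eq_mul, mul_comm]

theorem diverg_add {φ ψ : Euc N → Euc N} {x : Euc N}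
    (hφ : DifferentiableAt ℝ φ x) (hψ : DifferentiableAt ℝ ψ x) :
    diverg (fun y => φ y + ψ y) x = diverg φ x + diverg ψ x := by
  unfold diverg
  have h1 : fderiv ℝ (fun y => φ y + ψ y) x = _ := fderiv_fun_add hφ hψ
  simp [h1, Finset.sum_add_distrib]

theorem diverg_const_smul (c : ℝ) {φ : Euc N → Euc N} {x : Euc N}
    (hφ : DifferentiableAt ℝ φ x) :
    diverg (fun y => c • φ y) x = c * diverg φ x := by
  unfold diverg
  have h1 : fderiv ℝ (fun y => c • φ y) x = _ := fderiv_fun_const_smul hφ c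
  simp [h1, Finset.mul_sum]

theorem diverg_translate (φ : Euc N → Euc N) (x y : Euc N) :
    diverg (fun z => φ (z + y)) x = diverg φ (x + y) := by
  unfold diverg
  rw [fderiv_comp_add_right]

theorem CF.smul {φ : Euc N → Euc N} (h : CF φ) {u : Euc N → ℝ} (hu : ContDiff ℝ 1 u) :
    CF (fun x => u x • φ x) := by
  refine ⟨ContDiff.fun_smul hu h.cd, h.cs.mono fun x hx => ?_⟩
  contrapose! hx
  have : φ x = 0 := by simpa using hx
  simp [this]

theorem CF.add {φ ψ : Euc N → Euc N} (h : CF φ) (h' : CF ψ) :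
    CF (fun x => φ x + ψ x) := ⟨h.cd.add h'.cd, h.cs.add h'.cs⟩

theorem CF.translate {φ : Euc N → Euc N} (h : CF φ) (y : Euc N) :
    CF (fun x => φ (x + y)) :=
  ⟨h.cd.comp (contDiff_id.add contDiff_const), h.cs.comp_homeomorph (Homeomorph.addRight y)⟩

theorem CF.integral_div {φ : Euc N → Euc N} (h : CF φ) : ∫ x, diverg φ x = 0 := by
  have hint : ∀ v : Euc N, Integrable (fun x => fderiv ℝ φ x v) := fun v => by
    refine Continuous.integrable_of_hasCompactSupport
      ((h.cd.continuous_fderiv (by norm_num)).clm_apply continuous_const) ?_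
    exact (h.cs.fderiv ℝ).comp_left (g := fun L : Euc N →L[ℝ] Euc N => L v) (by simp)
  have key : ∀ v : Euc N, ∫ x, fderiv ℝ φ x v = 0 := by
    intro v
    have := integral_smul_fderiv_eq_neg_fderiv_smul_of_integrable (μ := (volume : Measure (Euc N)))
      (f := fun _ : Euc N => (1 : ℝ)) (g := φ) (v := v) (by simp) (by simpa using hint v)
      (by simpa using h.cd.continuous.integrable_of_hasCompactSupport h.cs)
      (fun x _ => by fun_prop) (fun x _ => h.diff x)
    simpa using this
  unfold diverg
  have hc : ∀ i : Fin N, Integrable (fun x => fderiv ℝ φ x (EuclideanSpace.single i 1) i) :=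
    fun i => (EuclideanSpace.proj i : Euc N →L[ℝ] ℝ).integrable_comp
      (hint (EuclideanSpace.single i 1))
  rw [integral_finsetSum _ fun i _ => hc i]
  refine Finset.sum_eq_zero fun i _ => ?_
  have := (EuclideanSpace.proj i : Euc N →L[ℝ] ℝ).integral_comp_comm
      (hint (EuclideanSpace.single i 1))
  rw [key] at this
  simpa using this

theorem CF.ibp {φ : Euc N → Euc N} (h : CF φ) {u : Euc N → ℝ} (hu : ContDiff ℝ 1 u) :
    ∫ x, u x * diverg φ x = - ∫ x, fderiv ℝ u x (φ x) := by
  have h0 := (h.smul hu).integral_div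
  have hd : Differentiable ℝ u := hu.differentiable (by norm_num)
  have e : ∀ x, diverg (fun y => u y • φ y) x = u x * diverg φ x + fderiv ℝ u x (φ x) :=
    fun x => diverg_smul (hd x) (h.diff x)
  simp_rw [e] at h0
  rw [integral_add] at h0
  · linarith
  · exact (hu.continuous.mul h.cont_div).integrable_of_hasCompactSupport h.cs_div.mul_left
  · refine Continuous.integrable_of_hasCompactSupport
      ((hu.continuous_fderiv (by norm_num)).clm_apply h.cd.continuous) ?_
    refine h.cs.mono fun x hx => ?_
    contrapose! hx
    have : φ x = 0 := by simpa using hx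
    simp [this]

theorem testVF_zero (Ω : Set (Euc N)) : (fun _ => 0 : Euc N → Euc N) ∈ TestVF Ω := by
  refine ⟨contDiff_const, HasCompactSupport.zero, ?_, by simp⟩
  have : tsupport (fun _ => 0 : Euc N → Euc N) = ∅ := by
    rw [tsupport_eq_empty_iff]; rfl
  simp [this]

theorem diverg_zero (x : Euc N) : diverg (fun _ => 0 : Euc N → Euc N) x = 0 := by
  simp [diverg]

theorem VB.nonneg {Ω : Set (Euc N)} {f : Euc N → ℝ} {c : ℝ} (h : VB Ω f c) : 0 ≤ c := by
  have := h _ (testVF_zero Ω)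
  simpa [diverg_zero] using this

/-- scaling -/
theorem VB.scale {Ω : Set (Euc N)} {f : Euc N → ℝ} {c k : ℝ} (h : VB Ω f c) (hk : 0 < k)
    {φ : Euc N → Euc N} (hφ : CF φ) (hs : tsupport φ ⊆ Ω) (hb : ∀ x, ‖φ x‖ ≤ k) :
    ∫ x, f x * diverg φ x ≤ k * c := by
  have h1 : (fun x => k⁻¹ • φ x) ∈ TestVF Ω := by
    refine ⟨(hφ.smul contDiff_const).cd, (hφ.smul contDiff_const).cs,
      (closure_mono ?_).trans hs, fun x => ?_⟩
    · intro x hx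
      contrapose! hx
      have : φ x = 0 := by simpa using hx
      simp [this]
    · rw [norm_smul, Real.norm_eq_abs, abs_of_pos (inv_pos.2 hk), inv_mul_le_iff₀ hk, mul_one]
      exact hb x
  have h2 := h _ h1
  have e : ∀ x, f x * diverg (fun x => k⁻¹ • φ x) x = k⁻¹ * (f x * diverg φ x) := fun x => by
    rw [diverg_const_smul _ (hφ.diff x)]; ring
  simp_rw [e] at h2
  rw [integral_const_mul, inv_mul_le_iff₀ hk] at h2
  exact h2

/-- lower semicontinuity -/
theorem VB.limit {Ω : Set (Euc N)} {F : ℕ → Euc N → ℝ} {f : Euc N → ℝ} {c : ℝ}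
    (hF : ∀ n, Adm (F n)) (h : ∀ n, VB Ω (F n) c)
    (hl : ∀ᵐ x, Tendsto (fun n => F n x) atTop (𝓝 (f x))) : VB Ω f c := by
  intro φ hφ
  have hc := TestVF.cf hφ
  refine le_of_tendsto (f := fun n => ∫ x, F n x * diverg φ x) (x := atTop) ?_
    (Eventually.of_forall fun n => h n φ hφ)
  refine tendsto_integral_of_dominated_convergence (fun x => ‖diverg φ x‖)
    (fun n => ((hF n).int_mul hc.int_div).aestronglyMeasurable) hc.int_div.norm (fun n => ?_) ?_
  · refine Eventually.of_forall fun x => ?_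
    rw [norm_mul]
    exact mul_le_of_le_one_left (norm_nonneg _) ((hF n).abs_le x)
  · filter_upwards [hl] with x hx
    exact hx.mul_const _

/-! ### Mollification -/

/-- the standard bump of radius `1/(n+1)` -/
def bmp (N n : ℕ) : ContDiffBump (0 : Euc N) where
  rIn := 1 / (2 * ((n : ℝ) + 1))
  rOut := 1 / ((n : ℝ) + 1)
  rIn_pos := by positivity
  rIn_lt_rOut := by
    apply one_div_lt_one_div_of_lt
    · positivity
    · have : (0 : ℝ) ≤ n := n.cast_nonneg
      linarith

/-- mollifier -/
def rho (N n : ℕ) : Euc N → ℝ := (bmp N n).normed volume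

/-- mollification -/
def mol (n : ℕ) (f : Euc N → ℝ) : Euc N → ℝ :=
  MeasureTheory.convolution (rho N n) f (ContinuousLinearMap.lsmul ℝ ℝ) volume

theorem rho_nonneg (n : ℕ) (x : Euc N) : 0 ≤ rho N n x := (bmp N n).nonneg_normed x

theorem rho_int (n : ℕ) : Integrable (rho N n) := (bmp N n).integrable_normed

theorem rho_integral (n : ℕ) : ∫ x, rho N n x = 1 := (bmp N n).integral_normed

theorem rho_zero (n : ℕ) (x : Euc N) (hx : 1 / ((n : ℝ) + 1) ≤ ‖x‖) : rho N n x = 0 := by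
  have h := (bmp N n).support_normed_eq (μ := (volume : Measure (Euc N)))
  by_contra hne
  have : x ∈ Function.support ((bmp N n).normed volume) := hne
  rw [h, mem_ball_zero_iff] at this
  exact absurd this (not_lt.2 hx)

theorem rOut_tendsto : Tendsto (fun n => (bmp N n).rOut) atTop (𝓝 0) :=
  tendsto_one_div_add_atTop_nhds_zero_nat

theorem rOut_le (n : ℕ) : (bmp N n).rOut ≤ 2 * (bmp N n).rIn := by
  change 1 / ((n : ℝ) + 1) ≤ 2 * (1 / (2 * ((n : ℝ) + 1)))
  have : (0 : ℝ) < (n : ℝ) + 1 := by positivity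
  apply le_of_eq; field_simp

theorem mol_contDiff (n : ℕ) {f : Euc N → ℝ} (hf : Adm f) {k : ℕ∞} : ContDiff ℝ k (mol n f) :=
  (bmp N n).hasCompactSupport_normed.contDiff_convolution_left _ (bmp N n).contDiff_normed hf.locInt

theorem mol_exists (n : ℕ) {f : Euc N → ℝ} (hf : Adm f) (x : Euc N) :
    Integrable (fun t => rho N n t * f (x - t)) :=
  ((bmp N n).hasCompactSupport_normed.convolutionExists_left (ContinuousLinearMap.lsmul ℝ ℝ)
    (bmp N n).continuous_normed hf.locInt x).integrable

theorem mol_apply (n : ℕ) (f : Euc N → ℝ) (x : Euc N) :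
    mol n f x = ∫ t, rho N n t * f (x - t) := rfl

theorem mol_adm (n : ℕ) {f : Euc N → ℝ} (hf : Adm f) : Adm (mol n f) := by
  refine ⟨(mol_contDiff n hf (k := 0)).continuous.aestronglyMeasurable, fun x => ?_, fun x => ?_⟩
  · exact integral_nonneg fun t => mul_nonneg (rho_nonneg n t) (hf.nonneg _)
  · rw [mol_apply, ← rho_integral (N := N) n]
    exact integral_mono (mol_exists n hf x) (rho_int n)
      fun t => mul_le_of_le_one_right (rho_nonneg n t) (hf.le_one _)

theorem mol_ae {f : Euc N → ℝ} (hf : Adm f) :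
    ∀ᵐ x, Tendsto (fun n => mol n f x) atTop (𝓝 (f x)) :=
  ContDiffBump.ae_convolution_tendsto_right_of_locallyIntegrable (φ := bmp N) rOut_tendsto
    (Eventually.of_forall rOut_le) hf.locInt

theorem mol_prod_int (n : ℕ) {f g : Euc N → ℝ} (hf : Adm f) (hg : Integrable g) :
    Integrable (fun p : Euc N × Euc N => rho N n p.2 * f (p.1 - p.2) * g p.1)
      (volume.prod volume) := by
  have h1 : Integrable (fun p : Euc N × Euc N => g p.1 * rho N n p.2) (volume.prod volume) :=
    hg.mul_prod (rho_int n)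
  have h2 : AEStronglyMeasurable (fun p : Euc N × Euc N => f (p.1 - p.2)) (volume.prod volume) :=
    hf.meas.comp_quasiMeasurePreserving (quasiMeasurePreserving_sub volume volume)
  refine (h1.bdd_mul h2 (Eventually.of_forall fun p => hf.abs_le _)).congr ?_
  exact Eventually.of_forall fun p => by ring

theorem mol_inner (n : ℕ) (f g : Euc N → ℝ) (y : Euc N) :
    ∫ x, rho N n y * f (x - y) * g x = rho N n y * ∫ x, f x * g (x + y) := by
  rw [← integral_const_mul]
  have := integral_sub_right_eq_self (μ := (volume : Measure (Euc N)))
    (fun x => rho N n y * (f x * g (x + y))) y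
  rw [← this]
  congr 1; ext x
  simp; ring

theorem mol_fubini (n : ℕ) {f g : Euc N → ℝ} (hf : Adm f) (hg : Integrable g) :
    ∫ x, mol n f x * g x = ∫ y, rho N n y * ∫ x, f x * g (x + y) := by
  simp_rw [mol_apply, ← integral_mul_const]
  rw [integral_integral_swap (mol_prod_int n hf hg)]
  simp_rw [mol_inner]

theorem mol_outer_int (n : ℕ) {f g : Euc N → ℝ} (hf : Adm f) (hg : Integrable g) :
    Integrable (fun y => rho N n y * ∫ x, f x * g (x + y)) := by
  have := (mol_prod_int n hf hg).integral_prod_right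
  simpa only [mol_inner] using this

theorem mol_avg (n : ℕ) {f g : Euc N → ℝ} (hf : Adm f) (hg : Integrable g) {c : ℝ}
    (h : ∀ y : Euc N, ‖y‖ < 1 / ((n : ℝ) + 1) → ∫ x, f x * g (x + y) ≤ c) :
    ∫ x, mol n f x * g x ≤ c := by
  rw [mol_fubini n hf hg]
  calc _ ≤ ∫ y, rho N n y * c := by
        refine integral_mono (mol_outer_int n hf hg) ((rho_int n).mul_const _) fun y => ?_
        by_cases hy : ‖y‖ < 1 / ((n : ℝ) + 1)
        · exact mul_le_mul_of_nonneg_left (h y hy) (rho_nonneg n y)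
        · simp [rho_zero n y (not_lt.1 hy)]
    _ = c := by rw [integral_mul_const, rho_integral, one_mul]

/-- translates stay in an open set -/
theorem exists_translate {K Ω : Set (Euc N)} (hK : IsCompact K) (hΩ : IsOpen Ω) (h : K ⊆ Ω) :
    ∃ n₀ : ℕ, ∀ n ≥ n₀, ∀ y : Euc N, ‖y‖ < 1 / ((n : ℝ) + 1) → ∀ x, x + y ∈ K → x ∈ Ω := by
  obtain ⟨δ, hδ, hd⟩ := hK.exists_thickening_subset_open hΩ h
  obtain ⟨n₀, hn₀⟩ := exists_nat_one_div_lt hδ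
  refine ⟨n₀, fun n hn y hy x hx => hd ?_⟩
  rw [mem_thickening_iff]
  refine ⟨x + y, hx, ?_⟩
  rw [dist_eq_norm]
  simp only [sub_add_cancel_left, norm_neg]
  have := one_div_le_one_div_of_le (a := (n₀ : ℝ) + 1) (b := (n : ℝ) + 1) (by positivity)
    (by simpa using hn)
  linarith

theorem tsupport_translate (φ : Euc N → Euc N) (y : Euc N) :
    tsupport (fun x => φ (x + y)) = {x | x + y ∈ tsupport φ} := by
  have := tsupport_comp_eq_preimage φ (Homeomorph.addRight y)
  exact this

theorem mol_density {A : Set (Euc N)} (hA : Adm (A.indicator 1)) (hmA : NullMeasurableSet A volume)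
    {x : Euc N} (hx : HasDensity A x 1) :
    Tendsto (fun n => mol n (A.indicator 1) x) atTop (𝓝 1) := by
  have hφ' : Tendsto (fun n => (bmp N n).rOut) atTop (𝓝[>] 0) :=
    tendsto_nhdsWithin_iff.2 ⟨rOut_tendsto, Eventually.of_forall (fun i ↦ (bmp N i).rOut_pos)⟩
  have h1 := hx.comp hφ'
  simp only [mol]
  simp only [convolution_eq_swap, ContinuousLinearMap.lsmul_apply]
  refine tendsto_integral_smul_of_tendsto_average_norm_sub
    (a := fun n => ball x (bmp N n).rOut) (2 ^ (Module.finrank ℝ (Euc N))) ?_ ?_ ?_ ?_ ?_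
  · have key : ∀ n, ⨍ y in ball x (bmp N n).rOut, ‖A.indicator (1 : Euc N → ℝ) y - 1‖ =
        1 - (volume (A ∩ ball x (bmp N n).rOut) / volume (ball x (bmp N n).rOut)).toReal := by
      intro n
      have hb0 : volume.real (ball x (bmp N n).rOut) ≠ 0 :=
        (ENNReal.toReal_pos (measure_ball_pos volume x (bmp N n).rOut_pos).ne'
          measure_ball_lt_top.ne).ne'
      have e : ∀ y, ‖A.indicator (1 : Euc N → ℝ) y - 1‖ = 1 - A.indicator (1 : Euc N → ℝ) y := by
        intro y
        by_cases hy : y ∈ A <;> simp [hy]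
      simp_rw [e]
      have : IsFiniteMeasure (volume.restrict (ball x (bmp N n).rOut)) :=
        ⟨by simpa using measure_ball_lt_top⟩
      rw [setAverage_eq, integral_sub (integrable_const _)
        (hA.locInt.integrableOn_isCompact (isCompact_closedBall x _) |>.mono_set ball_subset_closedBall)]
      have e2 : ∫ y in ball x (bmp N n).rOut, A.indicator (1 : Euc N → ℝ) y =
          volume.real (A ∩ ball x (bmp N n).rOut) := by
        rw [integral_indicator₀ (hmA.mono_ac Measure.restrict_le_self.absolutelyContinuous)]
        rw [Measure.restrict_restrict₀ (hmA.mono_ac Measure.restrict_le_self.absolutelyContinuous)]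
        simp
      rw [e2]
      simp only [integral_const, smul_eq_mul, mul_one, ENNReal.toReal_div, measureReal_def,
        Measure.restrict_apply MeasurableSet.univ, univ_inter]
      rw [measureReal_def] at hb0
      field_simp
    simp_rw [key]
    have := (ENNReal.tendsto_toReal (by simp)).comp h1
    have := this.const_sub 1
    simpa using this
  · filter_upwards with n
    exact (hA.locInt.integrableOn_isCompact (isCompact_closedBall x _)).mono_set
      ball_subset_closedBall
  · apply tendsto_const_nhds.congr (fun i ↦ ?_)
    rw [← integral_neg_eq_self]
    simp only [sub_neg_eq_add, integral_add_left_eq_self, rho_integral]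
  · filter_upwards with i
    intro y hy
    by_contra hn
    apply hy
    apply rho_zero
    rw [mem_ball, not_lt, dist_comm, dist_eq_norm] at hn
    exact hn
  · filter_upwards with i y
    rw [abs_of_nonneg (rho_nonneg _ _)]
    have := (bmp N i).normed_le_div_measure_closedBall_rOut (μ := volume) 2 (rOut_le i) (x - y)
    rw [← Measure.addHaar_real_closedBall_center volume x] at this
    refine this.trans ?_
    apply div_le_div_of_nonneg_left (by positivity)
    · exact ENNReal.toReal_pos (measure_ball_pos volume x (bmp N i).rOut_pos).ne'
        measure_ball_lt_top.ne
    · exact measureReal_mono ball_subset_closedBall measure_closedBall_lt_top.ne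

/-! ### Submodularity of the variation -/

/-- smooth positive part -/
def TT (r s : ℝ) : ℝ := (s + √(s ^ 2 + r ^ 2)) / 2

/-- derivative of the smooth positive part -/
def HH (r s : ℝ) : ℝ := (1 + s / √(s ^ 2 + r ^ 2)) / 2

theorem TT_deriv {r : ℝ} (hr : 0 < r) (s : ℝ) : HasDerivAt (TT r) (HH r s) s := by
  have hp : (0 : ℝ) < s ^ 2 + r ^ 2 := by positivity
  have h1 : HasDerivAt (fun s : ℝ => s ^ 2 + r ^ 2) (2 * s) s := by
    simpa using (hasDerivAt_pow 2 s).add_const (r ^ 2)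
  have h2 := h1.sqrt hp.ne'
  have h3 := ((hasDerivAt_id s).add h2).div_const 2
  refine h3.congr_deriv ?_
  unfold HH
  have : √(s ^ 2 + r ^ 2) ≠ 0 := (Real.sqrt_pos.2 hp).ne'
  field_simp

theorem TT_contDiff {r : ℝ} (hr : 0 < r) : ContDiff ℝ 1 (TT r) := by
  unfold TT
  refine (contDiff_id.add (ContDiff.sqrt (by fun_prop) fun s => ?_)).div_const 2
  positivity

theorem HH_contDiff {r : ℝ} (hr : 0 < r) : ContDiff ℝ 1 (HH r) := by
  unfold HH
  refine (contDiff_const.add (contDiff_id.div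
    (ContDiff.sqrt (by fun_prop) fun s => ?_) fun s => ?_)).div_const 2
  · positivity
  · positivity

theorem HH_mem {r : ℝ} (hr : 0 < r) (s : ℝ) : 0 ≤ HH r s ∧ HH r s ≤ 1 := by
  have hp : (0 : ℝ) < √(s ^ 2 + r ^ 2) := by positivity
  have h1 : |s| ≤ √(s ^ 2 + r ^ 2) := by
    rw [← Real.sqrt_sq_eq_abs]
    exact Real.sqrt_le_sqrt (by nlinarith [sq_nonneg r])
  have h2 := abs_le.1 h1
  have h3 : s / √(s ^ 2 + r ^ 2) ≤ 1 := (div_le_one hp).2 h2.2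
  have h4 : -1 ≤ s / √(s ^ 2 + r ^ 2) := (le_div_iff₀ hp).2 (by linarith)
  unfold HH
  constructor <;> linarith

theorem TT_bound {r s : ℝ} (hr : 0 ≤ r) (hr1 : r ≤ 1) (hs : |s| ≤ 1) : |TT r s| ≤ 2 := by
  have h1 : √(s ^ 2 + r ^ 2) ≤ 2 := by
    rw [Real.sqrt_le_left (by norm_num)]
    have : s ^ 2 ≤ 1 := by rw [sq_le_one_iff_abs_le_one]; exact hs
    nlinarith
  have h0 := Real.sqrt_nonneg (s ^ 2 + r ^ 2)
  have h2 := abs_le.1 hs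
  unfold TT
  rw [abs_le]
  constructor <;> linarith

theorem TT_zero (s : ℝ) : TT 0 s = max s 0 := by
  unfold TT
  simp only [ne_eq, OfNat.ofNat_ne_zero, not_false_eq_true, zero_pow, add_zero, Real.sqrt_sq_eq_abs]
  rcases le_total 0 s with h | h
  · rw [abs_of_nonneg h, max_eq_left h]; ring
  · rw [abs_of_nonpos h, max_eq_right h]; ring

theorem CF.int_fderiv {φ : Euc N → Euc N} (h : CF φ) {u : Euc N → ℝ} (hu : ContDiff ℝ 1 u) :
    Integrable (fun x => fderiv ℝ u x (φ x)) := by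
  refine Continuous.integrable_of_hasCompactSupport
    ((hu.continuous_fderiv (by norm_num)).clm_apply h.cd.continuous) ?_
  refine h.cs.mono fun x hx => ?_
  contrapose! hx
  have : φ x = 0 := by simpa using hx
  simp [this]

theorem smooth_identity {φ ψ : Euc N → Euc N} (hφ : CF φ) (hψ : CF ψ) {u v : Euc N → ℝ}
    (hu : ContDiff ℝ 1 u) (hv : ContDiff ℝ 1 v) {r : ℝ} (hr : 0 < r) :
    (∫ x, (v x + TT r (u x - v x)) * diverg φ x) + ∫ x, (u x - TT r (u x - v x)) * diverg ψ x =
    (∫ x, u x * diverg (fun y => HH r (u y - v y) • φ y + (1 - HH r (u y - v y)) • ψ y) x) +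
    ∫ x, v x * diverg (fun y => (1 - HH r (u y - v y)) • φ y + HH r (u y - v y) • ψ y) x := by
  have hw : ContDiff ℝ 1 (fun x => HH r (u x - v x)) := (HH_contDiff hr).comp (hu.sub hv)
  have hw' : ContDiff ℝ 1 (fun x => 1 - HH r (u x - v x)) := contDiff_const.sub hw
  have hT : ContDiff ℝ 1 (fun x => TT r (u x - v x)) := (TT_contDiff hr).comp (hu.sub hv)
  have hdu : Differentiable ℝ u := hu.differentiable (by norm_num)
  have hdv : Differentiable ℝ v := hv.differentiable (by norm_num)
  have hfT : ∀ x, HasFDerivAt (fun x => TT r (u x - v x))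
      (HH r (u x - v x) • (fderiv ℝ u x - fderiv ℝ v x)) x := by
    intro x
    have h1 : HasFDerivAt (fun x => u x - v x) (fderiv ℝ u x - fderiv ℝ v x) x :=
      (hdu x).hasFDerivAt.fun_sub (hdv x).hasFDerivAt
    exact HasDerivAt.comp_hasFDerivAt (h₂ := TT r) x (TT_deriv hr (u x - v x)) h1
  have hA : ContDiff ℝ 1 (fun x => v x + TT r (u x - v x)) := hv.add hT
  have hB : ContDiff ℝ 1 (fun x => u x - TT r (u x - v x)) := hu.sub hT
  have hC := (hφ.smul hw).add (hψ.smul hw')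
  have hD := (hφ.smul hw').add (hψ.smul hw)
  rw [hφ.ibp hA, hψ.ibp hB, hC.ibp hu, hD.ibp hv, ← neg_add, ← neg_add,
    ← integral_add (hφ.int_fderiv hA) (hψ.int_fderiv hB),
    ← integral_add (hC.int_fderiv hu) (hD.int_fderiv hv)]
  congr 2; ext x
  have eA := ((hdv x).hasFDerivAt.add (hfT x)).fderiv
  have eB := ((hdu x).hasFDerivAt.sub (hfT x)).fderiv
  have eA' : fderiv ℝ (fun x => v x + TT r (u x - v x)) x = _ := eA
  have eB' : fderiv ℝ (fun x => u x - TT r (u x - v x)) x = _ := eB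
  rw [eA', eB']
  simp only [add_apply, sub_apply, smul_apply, map_add, map_smul, smul_eq_mul]
  ring

theorem comb_norm {w : ℝ} (h0 : 0 ≤ w) (h1 : w ≤ 1) {a b : Euc N} (ha : ‖a‖ ≤ 1) (hb : ‖b‖ ≤ 1) :
    ‖w • a + (1 - w) • b‖ ≤ 1 := by
  have := (convex_closedBall (0 : Euc N) 1) (x := a) (by simpa using ha) (y := b)
    (by simpa using hb) h0 (sub_nonneg.2 h1) (by ring)
  simpa using this

/-- mollification does not increase the variation -/
theorem mol_VB {Ω K : Set (Euc N)} {f : Euc N → ℝ} {c : ℝ} (hf : Adm f) (h : VB Ω f c) {n : ℕ}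
    (hK : ∀ y : Euc N, ‖y‖ < 1 / ((n : ℝ) + 1) → ∀ x, x + y ∈ K → x ∈ Ω)
    {Φ : Euc N → Euc N} (hΦ : CF Φ) (hs : tsupport Φ ⊆ K) (hb : ∀ x, ‖Φ x‖ ≤ 1) :
    ∫ x, mol n f x * diverg Φ x ≤ c := by
  refine mol_avg n hf hΦ.int_div fun y hy => ?_
  have : (fun x => Φ (x + y)) ∈ TestVF Ω := by
    refine ⟨(hΦ.translate y).cd, (hΦ.translate y).cs, ?_, fun x => hb _⟩
    rw [tsupport_translate]
    exact fun x hx => hK y hy x (hs hx)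
  have := h _ this
  simpa only [diverg_translate] using this

theorem tsupport_comb {a b : Euc N → ℝ} {φ ψ : Euc N → Euc N} :
    tsupport (fun x => a x • φ x + b x • ψ x) ⊆ tsupport φ ∪ tsupport ψ := by
  refine closure_minimal (fun x hx => ?_) ((isClosed_tsupport _).union (isClosed_tsupport _))
  by_contra hn
  rw [mem_union, not_or] at hn
  apply hx
  simp [image_eq_zero_of_notMem_tsupport hn.1, image_eq_zero_of_notMem_tsupport hn.2]

theorem submod {Ω : Set (Euc N)} (hΩ : IsOpen Ω) {f g : Euc N → ℝ} (hf : Adm f) (hg : Adm g)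
    {c d : ℝ} (hc : VB Ω f c) (hd : VB Ω g d) {φ ψ : Euc N → Euc N} (hφ : φ ∈ TestVF Ω)
    (hψ : ψ ∈ TestVF Ω) :
    (∫ x, max (f x) (g x) * diverg φ x) + ∫ x, min (f x) (g x) * diverg ψ x ≤ c + d := by
  have cφ := TestVF.cf hφ
  have cψ := TestVF.cf hψ
  obtain ⟨n₀, hn₀⟩ := exists_translate (hφ.2.1.isCompact.union hψ.2.1.isCompact) hΩ
    (union_subset hφ.2.2.1 hψ.2.2.1)
  let r : ℕ → ℝ := fun n => 1 / ((n : ℝ) + 1)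
  have hr : ∀ n, 0 < r n := fun n => by positivity
  have hr1 : ∀ n, r n ≤ 1 := fun n => by
    rw [div_le_one (by positivity)]
    have : (0 : ℝ) ≤ n := n.cast_nonneg
    linarith
  have hrt : Tendsto r atTop (𝓝 0) := tendsto_one_div_add_atTop_nhds_zero_nat
  have step : ∀ n ≥ n₀,
      (∫ x, (mol n g x + TT (r n) (mol n f x - mol n g x)) * diverg φ x) +
      ∫ x, (mol n f x - TT (r n) (mol n f x - mol n g x)) * diverg ψ x ≤ c + d := by
    intro n hn
    have hu : ContDiff ℝ 1 (mol n f) := by exact_mod_cast mol_contDiff n hf (k := 1)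
    have hv : ContDiff ℝ 1 (mol n g) := by exact_mod_cast mol_contDiff n hg (k := 1)
    have hw : ContDiff ℝ 1 (fun x => HH (r n) (mol n f x - mol n g x)) :=
      (HH_contDiff (hr n)).comp (hu.sub hv)
    have hw' : ContDiff ℝ 1 (fun x => 1 - HH (r n) (mol n f x - mol n g x)) :=
      contDiff_const.sub hw
    rw [smooth_identity cφ cψ hu hv (hr n)]
    refine add_le_add ?_ ?_
    · refine mol_VB hf hc (hn₀ n hn) ((cφ.smul hw).add (cψ.smul hw')) tsupport_comb fun x => ?_
      have := HH_mem (hr n) (mol n f x - mol n g x)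
      exact comb_norm this.1 this.2 (hφ.2.2.2 x) (hψ.2.2.2 x)
    · refine mol_VB hg hd (hn₀ n hn) ((cφ.smul hw').add (cψ.smul hw)) tsupport_comb fun x => ?_
      have := HH_mem (hr n) (mol n f x - mol n g x)
      rw [add_comm]
      exact comb_norm this.1 this.2 (hψ.2.2.2 x) (hφ.2.2.2 x)
  have hTc : Continuous fun p : ℝ × ℝ => TT p.1 p.2 := by unfold TT; fun_prop
  have hTl : ∀ᵐ x, Tendsto (fun n => TT (r n) (mol n f x - mol n g x)) atTop
      (𝓝 (max (f x - g x) 0)) := by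
    filter_upwards [mol_ae hf, mol_ae hg] with x h1 h2
    rw [← TT_zero]
    exact (hTc.tendsto (0, f x - g x)).comp (hrt.prodMk_nhds (h1.sub h2))
  have hTb : ∀ n x, |TT (r n) (mol n f x - mol n g x)| ≤ 2 := fun n x => by
    refine TT_bound (hr n).le (hr1 n) ?_
    have h1 := mol_adm n hf
    have h2 := mol_adm n hg
    rw [abs_le]
    constructor
    · linarith [h1.nonneg x, h2.le_one x]
    · linarith [h2.nonneg x, h1.le_one x]
  have hcu : ∀ n, Continuous (mol n f) := fun n => (mol_contDiff n hf (k := 0)).continuous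
  have hcv : ∀ n, Continuous (mol n g) := fun n => (mol_contDiff n hg (k := 0)).continuous
  have hcT : ∀ n, Continuous fun x => TT (r n) (mol n f x - mol n g x) := fun n =>
    hTc.comp (continuous_const.prodMk ((hcu n).sub (hcv n)))
  have lim1 : Tendsto
      (fun n => ∫ x, (mol n g x + TT (r n) (mol n f x - mol n g x)) * diverg φ x) atTop
      (𝓝 (∫ x, max (f x) (g x) * diverg φ x)) := by
    refine tendsto_integral_of_dominated_convergence (fun x => 3 * ‖diverg φ x‖)
      (fun n => (((hcv n).add (hcT n)).mul cφ.cont_div).aestronglyMeasurable)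
      (cφ.int_div.norm.const_mul 3) (fun n => Eventually.of_forall fun x => ?_) ?_
    · rw [norm_mul]
      refine mul_le_mul_of_nonneg_right ?_ (norm_nonneg _)
      refine (norm_add_le _ _).trans ?_
      have h1 := (mol_adm n hg).abs_le x
      have h2 := hTb n x
      rw [← Real.norm_eq_abs] at h2
      linarith
    · filter_upwards [hTl, mol_ae hg] with x h1 h2
      have := (h2.add h1).mul_const (diverg φ x)
      convert this using 3
      rcases le_total (f x) (g x) with h | h
      · rw [max_eq_right h, max_eq_right (by linarith)]; ring
      · rw [max_eq_left h, max_eq_left (by linarith)]; ring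
  have lim2 : Tendsto
      (fun n => ∫ x, (mol n f x - TT (r n) (mol n f x - mol n g x)) * diverg ψ x) atTop
      (𝓝 (∫ x, min (f x) (g x) * diverg ψ x)) := by
    refine tendsto_integral_of_dominated_convergence (fun x => 3 * ‖diverg ψ x‖)
      (fun n => (((hcu n).sub (hcT n)).mul cψ.cont_div).aestronglyMeasurable)
      (cψ.int_div.norm.const_mul 3) (fun n => Eventually.of_forall fun x => ?_) ?_
    · rw [norm_mul]
      refine mul_le_mul_of_nonneg_right ?_ (norm_nonneg _)
      refine (norm_sub_le _ _).trans ?_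
      have h1 := (mol_adm n hf).abs_le x
      have h2 := hTb n x
      rw [← Real.norm_eq_abs] at h2
      linarith
    · filter_upwards [hTl, mol_ae hf] with x h1 h2
      have := (h2.sub h1).mul_const (diverg ψ x)
      convert this using 3
      rcases le_total (f x) (g x) with h | h
      · rw [min_eq_left h, max_eq_right (by linarith)]; ring
      · rw [min_eq_right h, max_eq_left (by linarith)]; ring
  exact le_of_tendsto (lim1.add lim2) (eventually_atTop.2 ⟨n₀, step⟩)

/-! ### Local smoothing -/

theorem Adm.comb {f g ζ : Euc N → ℝ} (hf : Adm f) (hg : Adm g) (hζ : Adm ζ) :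
    Adm (fun x => ζ x * f x + (1 - ζ x) * g x) := by
  refine ⟨(hζ.meas.mul hf.meas).add ((aestronglyMeasurable_const.sub hζ.meas).mul hg.meas),
    fun x => ?_, fun x => ?_⟩
  · have := hζ.le_one x
    exact add_nonneg (mul_nonneg (hζ.nonneg x) (hf.nonneg x))
      (mul_nonneg (by linarith) (hg.nonneg x))
  · nlinarith [hζ.le_one x, hζ.nonneg x, hf.le_one x, hg.le_one x]

theorem mol_L1 {a : Euc N → ℝ} (ha : Adm a) {h : Euc N → ℝ} (hh : Integrable h) :
    Tendsto (fun n => ∫ x, |mol n a x - a x| * |h x|) atTop (𝓝 0) := by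
  have : Tendsto (fun n => ∫ x, |mol n a x - a x| * |h x|) atTop (𝓝 (∫ _ : Euc N, (0 : ℝ))) := by
    refine tendsto_integral_of_dominated_convergence (fun x => ‖h x‖)
      (fun n => ?_) hh.norm (fun n => Eventually.of_forall fun x => ?_) ?_
    · have h1 : AEStronglyMeasurable (fun x => |mol n a x - a x|) volume :=
        ((mol_adm n ha).meas.sub ha.meas).norm
      exact h1.mul hh.aestronglyMeasurable.norm
    · rw [norm_mul, Real.norm_eq_abs, abs_abs, Real.norm_eq_abs, abs_abs, Real.norm_eq_abs]
      refine mul_le_of_le_one_left (abs_nonneg _) ?_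
      have h1 := mol_adm n ha
      rw [abs_le]
      constructor
      · linarith [h1.nonneg x, ha.le_one x]
      · linarith [ha.nonneg x, h1.le_one x]
    · filter_upwards [mol_ae ha] with x hx
      have := ((hx.sub_const (a x)).abs).mul_const |h x|
      simpa using this
  simpa using this

theorem approx_bound {Ω : Set (Euc N)} {a ζ : Euc N → ℝ} (ha : Adm a) {P : ℝ}
    (hP : VB Ω a P) (hζ : ContDiff ℝ 1 ζ) (hζa : Adm ζ) {L : ℝ} (hL0 : 0 ≤ L)
    (hL : ∀ x y, ζ (x + y) - ζ x ≤ L * ‖y‖) (hζc : HasCompactSupport ζ) {n : ℕ}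
    (hK : ∀ y : Euc N, ‖y‖ < 1 / ((n : ℝ) + 1) → ∀ x, x + y ∈ tsupport ζ → x ∈ Ω) :
    VB Ω (fun x => ζ x * mol n a x + (1 - ζ x) * a x)
      ((1 + L * (1 / ((n : ℝ) + 1))) * P + ∫ x, |mol n a x - a x| * |‖fderiv ℝ ζ x‖|) := by
  intro φ hφ
  have cφ := TestVF.cf hφ
  have hζ' : ContDiff ℝ 1 (fun x => 1 - ζ x) := contDiff_const.sub hζ
  have c1 := cφ.smul hζ
  have c2 := cφ.smul hζ'
  have hdζ : Differentiable ℝ ζ := hζ.differentiable (by norm_num)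
  have e1 : ∀ x, diverg (fun y => ζ y • φ y) x = ζ x * diverg φ x + fderiv ℝ ζ x (φ x) :=
    fun x => diverg_smul (hdζ x) (cφ.diff x)
  have e2 : ∀ x, diverg (fun y => (1 - ζ y) • φ y) x =
      (1 - ζ x) * diverg φ x - fderiv ℝ ζ x (φ x) := fun x => by
    rw [diverg_smul (hζ'.differentiable (by norm_num) x) (cφ.diff x)]
    rw [fderiv_const_sub]
    simp; ring
  have hm := mol_adm n ha
  have i3 := cφ.int_fderiv hζ
  have i4 : Integrable (fun x => (a x - mol n a x) * fderiv ℝ ζ x (φ x)) := by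
    refine ((ha.int_mul i3).sub (hm.int_mul i3)).congr (Eventually.of_forall fun x => ?_)
    simp; ring
  have i2 : Integrable (fun x => ‖fderiv ℝ ζ x‖) :=
    ((hζ.continuous_fderiv (by norm_num)).integrable_of_hasCompactSupport (hζc.fderiv ℝ)).norm
  have i5 : Integrable (fun x => |mol n a x - a x| * |‖fderiv ℝ ζ x‖|) := by
    refine ((hm.int_mul i2).sub (ha.int_mul i2)).norm.congr (Eventually.of_forall fun x => ?_)
    simp only [Pi.sub_apply]
    rw [← sub_mul, norm_mul, Real.norm_eq_abs, Real.norm_eq_abs]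
  have I : ∫ x, (ζ x * mol n a x + (1 - ζ x) * a x) * diverg φ x =
      (∫ x, mol n a x * diverg (fun y => ζ y • φ y) x) +
      (∫ x, a x * diverg (fun y => (1 - ζ y) • φ y) x) +
      ∫ x, (a x - mol n a x) * fderiv ℝ ζ x (φ x) := by
    rw [← integral_add (hm.int_mul c1.int_div) (ha.int_mul c2.int_div),
      ← integral_add (f := fun x => mol n a x * diverg (fun y => ζ y • φ y) x +
        a x * diverg (fun y => (1 - ζ y) • φ y) x)
        ((hm.int_mul c1.int_div).add (ha.int_mul c2.int_div)) i4]
    congr 1; ext x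
    rw [e1, e2]; ring
  rw [I]
  have B3 : ∫ x, (a x - mol n a x) * fderiv ℝ ζ x (φ x) ≤
      ∫ x, |mol n a x - a x| * |‖fderiv ℝ ζ x‖| := by
    refine integral_mono i4 i5 fun x => ?_
    refine (le_abs_self _).trans ?_
    rw [abs_mul, abs_sub_comm, abs_of_nonneg (norm_nonneg (fderiv ℝ ζ x))]
    refine mul_le_mul_of_nonneg_left ?_ (abs_nonneg _)
    refine ((fderiv ℝ ζ x).le_opNorm (φ x)).trans ?_
    exact mul_le_of_le_one_right (norm_nonneg _) (hφ.2.2.2 x)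
  have B12 : ∫ x, mol n a x * diverg (fun y => ζ y • φ y) x ≤
      (1 + L * (1 / ((n : ℝ) + 1))) * P - ∫ x, a x * diverg (fun y => (1 - ζ y) • φ y) x := by
    refine mol_avg n ha c1.int_div fun y hy => ?_
    rw [le_sub_iff_add_le]
    have c3 := c1.translate y
    have hs := hP.scale (k := 1 + L * (1 / ((n : ℝ) + 1))) (by positivity) (c3.add c2) ?_ ?_
    · rw [← integral_add]
      · refine le_trans (le_of_eq ?_) hs
        congr 1; ext x
        rw [diverg_add (c3.diff x) (c2.diff x), diverg_translate (fun y => ζ y • φ y)]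
        ring
      · have := ha.int_mul c3.int_div
        simpa only [diverg_translate (fun y => ζ y • φ y)] using this
      · exact ha.int_mul c2.int_div
    · have h1 : tsupport (fun x => ζ (x + y) • φ (x + y)) ⊆ Ω := by
        rw [tsupport_translate (fun x => ζ x • φ x)]
        intro x hx
        exact hK y hy x (closure_mono (Function.support_smul_subset_left ζ φ) hx)
      have h2 : tsupport (fun x => (1 - ζ x) • φ x) ⊆ Ω :=
        (closure_mono (Function.support_smul_subset_right (fun x => 1 - ζ x) φ)).trans hφ.2.2.1
      have h3 := tsupport_comb (a := fun _ => 1) (b := fun _ => 1)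
        (φ := fun x => ζ (x + y) • φ (x + y)) (ψ := fun x => (1 - ζ x) • φ x)
      simp only [one_smul] at h3
      exact h3.trans (union_subset h1 h2)
    · intro x
      refine (norm_add_le _ _).trans ?_
      rw [norm_smul, norm_smul, Real.norm_of_nonneg (hζa.nonneg _),
        Real.norm_of_nonneg (sub_nonneg.2 (hζa.le_one x))]
      have h1 : ζ (x + y) * ‖φ (x + y)‖ ≤ ζ (x + y) :=
        mul_le_of_le_one_right (hζa.nonneg _) (hφ.2.2.2 _)
      have h2 : (1 - ζ x) * ‖φ x‖ ≤ 1 - ζ x :=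
        mul_le_of_le_one_right (sub_nonneg.2 (hζa.le_one x)) (hφ.2.2.2 _)
      have h3 := hL x y
      have h4 : L * ‖y‖ ≤ L * (1 / ((n : ℝ) + 1)) := mul_le_mul_of_nonneg_left hy.le hL0
      linarith
  linarith

theorem approx {Ω : Set (Euc N)} (hΩ : IsOpen Ω) {a ζ : Euc N → ℝ} (ha : Adm a) {P : ℝ}
    (hP : VB Ω a P) (hζ : ContDiff ℝ 1 ζ) (hζa : Adm ζ)
    (hζc : HasCompactSupport ζ) (hζs : tsupport ζ ⊆ Ω) {η : ℝ} (hη : 0 < η) :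
    ∀ᶠ n in atTop, VB Ω (fun x => ζ x * mol n a x + (1 - ζ x) * a x) (P + η) ∧
      ∫ x, |mol n a x - a x| * |ζ x| ≤ η := by
  obtain ⟨L, hL⟩ := hζ.lipschitzWith_of_hasCompactSupport hζc (by norm_num)
  obtain ⟨n₀, hn₀⟩ := exists_translate hζc.isCompact hΩ hζs
  have i1 : Integrable ζ := hζ.continuous.integrable_of_hasCompactSupport hζc
  have i2 : Integrable (fun x => ‖fderiv ℝ ζ x‖) :=
    ((hζ.continuous_fderiv (by norm_num)).integrable_of_hasCompactSupport (hζc.fderiv ℝ)).norm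
  have t1 := mol_L1 ha i1
  have t2 := mol_L1 ha i2
  have t3 : Tendsto (fun n : ℕ => (1 + (L : ℝ) * (1 / ((n : ℝ) + 1))) * P +
      ∫ x, |mol n a x - a x| * |‖fderiv ℝ ζ x‖|) atTop (𝓝 ((1 + (L : ℝ) * 0) * P + 0)) :=
    (((tendsto_one_div_add_atTop_nhds_zero_nat.const_mul _).const_add 1).mul_const P).add t2
  have l3 : (1 + (L : ℝ) * 0) * P + 0 < P + η := by linarith
  filter_upwards [eventually_ge_atTop n₀, t1.eventually_le_const hη,
    t3.eventually_le_const l3] with n h1 h2 h3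
  refine ⟨fun φ hφ => (approx_bound ha hP hζ hζa L.2 (fun x y => ?_) hζc (hn₀ n h1) φ hφ).trans h3,
    h2⟩
  have := hL.dist_le_mul (x + y) x
  rw [dist_eq_norm, dist_eq_norm, add_sub_cancel_left] at this
  exact (le_abs_self _).trans this

/-! ### Coarea: choosing a good level -/

theorem Adm.const {t : ℝ} (h0 : 0 ≤ t) (h1 : t ≤ 1) : Adm (fun _ : Euc N => t) :=
  ⟨aestronglyMeasurable_const, fun _ => h0, fun _ => h1⟩

theorem Adm.max {f g : Euc N → ℝ} (hf : Adm f) (hg : Adm g) : Adm (fun x => max (f x) (g x)) :=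
  ⟨hf.meas.sup hg.meas, fun x => le_max_of_le_left (hf.nonneg x),
    fun x => max_le (hf.le_one x) (hg.le_one x)⟩

theorem Adm.min {f g : Euc N → ℝ} (hf : Adm f) (hg : Adm g) : Adm (fun x => min (f x) (g x)) :=
  ⟨hf.meas.inf hg.meas, fun x => le_min (hf.nonneg x) (hg.nonneg x),
    fun x => min_le_of_left_le (hf.le_one x)⟩

theorem VB.const (Ω : Set (Euc N)) (t : ℝ) : VB Ω (fun _ => t) 0 := by
  intro φ hφ
  rw [integral_const_mul, (TestVF.cf hφ).integral_div, mul_zero]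

theorem coarea {Ω : Set (Euc N)} (hΩ : IsOpen Ω) {W : Euc N → ℝ} (hW : Adm W) {C : ℝ}
    (hC : VB Ω W C) {s c : ℝ} (hs0 : 0 < s) (hs1 : s < 1) (hc : C < c * (1 - s)) :
    ∃ t, s ≤ t ∧ t < 1 ∧ VB Ω ({x | t < W x}.indicator 1) c := by
  have hC0 := hC.nonneg
  have hcpos : 0 < c := by
    by_contra hn
    have : c * (1 - s) ≤ 0 := mul_nonpos_of_nonpos_of_nonneg (not_lt.1 hn) (by linarith)
    linarith
  let M : ℝ → ℝ := fun t => sSup {r | ∃ φ ∈ TestVF Ω, r = ∫ x, min (W x) t * diverg φ x}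
  have hne : ∀ t, {r | ∃ φ ∈ TestVF Ω, r = ∫ x, min (W x) t * diverg φ x}.Nonempty :=
    fun t => ⟨_, _, testVF_zero Ω, rfl⟩
  have hbC : ∀ t, 0 ≤ t → t ≤ 1 → VB Ω (fun x => min (W x) t) C := by
    intro t h0 h1 ψ hψ
    have := submod hΩ hW (Adm.const h0 h1) hC (VB.const Ω t) (testVF_zero Ω) hψ
    simpa [diverg_zero] using this
  have hMb : ∀ t, 0 ≤ t → t ≤ 1 → VB Ω (fun x => min (W x) t) (M t) := by
    intro t h0 h1 ψ hψ
    refine le_csSup ⟨C, ?_⟩ ⟨ψ, hψ, rfl⟩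
    rintro r ⟨φ, hφ, rfl⟩
    exact hbC t h0 h1 φ hφ
  have hMC : ∀ t, 0 ≤ t → t ≤ 1 → M t ≤ C := by
    intro t h0 h1
    refine csSup_le (hne t) ?_
    rintro r ⟨φ, hφ, rfl⟩
    exact hbC t h0 h1 φ hφ
  have hsub : ∀ t t', 0 ≤ t → t ≤ t' → t' ≤ 1 → ∀ φ ∈ TestVF Ω,
      M t + ∫ x, max (min (W x) t') t * diverg φ x ≤ M t' := by
    intro t t' h0 h1 h2 φ hφ
    rw [← le_sub_iff_add_le]
    refine csSup_le (hne t) ?_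
    rintro r ⟨ψ, hψ, rfl⟩
    have := submod hΩ (hW.min (Adm.const (h0.trans h1) h2)) (Adm.const h0 (h1.trans h2))
      (hMb t' (h0.trans h1) h2) (VB.const Ω t) hφ hψ
    have e : ∀ x, min (min (W x) t') t = min (W x) t := fun x => by
      rw [min_assoc, min_eq_right h1]
    simp_rw [e] at this
    linarith
  have hmono : ∀ t t', 0 ≤ t → t ≤ t' → t' ≤ 1 → M t ≤ M t' := by
    intro t t' h0 h1 h2
    have := hsub t t' h0 h1 h2 _ (testVF_zero Ω)
    simpa [diverg_zero] using this
  by_contra hno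
  push Not at hno
  -- at every level there is a step of large slope
  have hstep : ∀ t, s ≤ t → t < 1 → ∃ h, 0 < h ∧ t + h ≤ 1 ∧ M t + c * h ≤ M (t + h) := by
    intro t hst ht1
    have ht0 : 0 ≤ t := hs0.le.trans hst
    by_contra hcon
    push Not at hcon
    apply hno t hst ht1
    let h : ℕ → ℝ := fun n => (1 - t) * (1 / ((n : ℝ) + 1))
    have hh0 : ∀ n, 0 < h n := fun n => mul_pos (by linarith) (by positivity)
    have hh1 : ∀ n, t + h n ≤ 1 := fun n => by
      have : 1 / ((n : ℝ) + 1) ≤ 1 := by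
        rw [div_le_one (by positivity)]
        have : (0 : ℝ) ≤ n := n.cast_nonneg
        linarith
      have : h n ≤ (1 - t) * 1 := mul_le_mul_of_nonneg_left this (by linarith)
      linarith
    have hht : Tendsto h atTop (𝓝 0) := by
      have := (tendsto_one_div_add_atTop_nhds_zero_nat (𝕜 := ℝ)).const_mul (1 - t)
      rw [mul_zero] at this
      exact this
    have hadm : ∀ n, Adm (fun x => max (min (W x) (t + h n)) t) := fun n =>
      (hW.min (Adm.const (by linarith [hh0 n]) (hh1 n))).max (Adm.const ht0 ht1.le)
    refine VB.limit (F := fun n x => (h n)⁻¹ * (max (min (W x) (t + h n)) t - t)) (fun n => ?_)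
      (fun n φ hφ => ?_) (Eventually.of_forall fun x => ?_)
    · refine ⟨((hadm n).meas.sub aestronglyMeasurable_const).const_mul _, fun x => ?_, fun x => ?_⟩
      · exact mul_nonneg (inv_nonneg.2 (hh0 n).le) (sub_nonneg.2 (le_max_right _ _))
      · rw [inv_mul_le_iff₀ (hh0 n), mul_one, sub_le_iff_le_add]
        refine max_le ((min_le_right _ _).trans (by linarith)) (by linarith [hh0 n])
    · have cφ := TestVF.cf hφ
      have h1 := hsub t (t + h n) ht0 (by linarith [hh0 n]) (hh1 n) φ hφ
      have h2 := hcon (h n) (hh0 n) (hh1 n)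
      have e : ∀ x, (h n)⁻¹ * (max (min (W x) (t + h n)) t - t) * diverg φ x =
          (h n)⁻¹ * (max (min (W x) (t + h n)) t * diverg φ x - t * diverg φ x) := fun x => by ring
      simp_rw [e]
      rw [integral_const_mul, integral_sub ((hadm n).int_mul cφ.int_div) (cφ.int_div.const_mul t),
        integral_const_mul, cφ.integral_div, inv_mul_le_iff₀ (hh0 n)]
      linarith
    · by_cases hx : t < W x
      · have : ∀ᶠ n in atTop, h n < W x - t := hht.eventually_lt_const (by linarith)
        refine tendsto_const_nhds.congr' ?_
        filter_upwards [this] with n hn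
        have h1 : min (W x) (t + h n) = t + h n := min_eq_right (by linarith)
        have h2 : max (t + h n) t = t + h n := max_eq_left (by linarith [hh0 n])
        rw [h1, h2, add_sub_cancel_left, inv_mul_cancel₀ (hh0 n).ne']
        simp [hx]
      · refine tendsto_const_nhds.congr fun n => ?_
        have h1 : min (W x) (t + h n) = W x := min_eq_left (by linarith [hh0 n])
        have h2 : max (W x) t = t := max_eq_right (by linarith)
        rw [h1, h2]
        simp [hx]
  -- real induction
  let T : Set ℝ := {t | s ≤ t ∧ t ≤ 1 ∧ M s + c * (t - s) ≤ M t}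
  have hsT : s ∈ T := ⟨le_rfl, hs1.le, by simp⟩
  have hTb : BddAbove T := ⟨1, fun t ht => ht.2.1⟩
  have hτs : s ≤ sSup T := le_csSup hTb hsT
  have hτ1 : sSup T ≤ 1 := csSup_le ⟨s, hsT⟩ fun t ht => ht.2.1
  have hτT : M s + c * (sSup T - s) ≤ M (sSup T) := by
    have : sSup T ≤ s + (M (sSup T) - M s) / c := by
      refine csSup_le ⟨s, hsT⟩ fun t ht => ?_
      have h1 := hmono t (sSup T) (hs0.le.trans ht.1) (le_csSup hTb ht) hτ1
      have h2 : t - s ≤ (M (sSup T) - M s) / c := by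
        rw [le_div_iff₀ hcpos]
        linarith [ht.2.2]
      linarith
    have h2 : sSup T - s ≤ (M (sSup T) - M s) / c := by linarith
    rw [le_div_iff₀ hcpos] at h2
    linarith
  rcases hτ1.lt_or_eq with hlt | heq
  · obtain ⟨h, h0, h1, h2⟩ := hstep _ hτs hlt
    have : sSup T + h ∈ T := ⟨by linarith, h1, by linarith⟩
    have := le_csSup hTb this
    linarith
  · rw [heq] at hτT
    have h1 := hMC 1 zero_le_one le_rfl
    have h2 := (hMb s hs0.le hs1.le).nonneg
    linarith

/-- gluing step -/
theorem glue {Ω : Set (Euc N)} (hΩ : IsOpen Ω) {a W f : Euc N → ℝ} (ha : Adm a) (hW : Adm W)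
    (hf : Adm f) (haW : ∀ x, a x ≤ W x) {c P η : ℝ} (hc : VB Ω W c) (hfP : VB Ω f (P + η))
    {ψ : Euc N → Euc N} (hψ : ψ ∈ TestVF Ω) (h1 : P - η ≤ ∫ x, a x * diverg ψ x)
    (h2 : ∫ x, |f x - a x| * |diverg ψ x| ≤ η) :
    VB Ω (fun x => max (W x) (f x)) (c + 3 * η) := by
  intro φ hφ
  have cψ := TestVF.cf hψ
  have h := submod hΩ hW hf hc hfP hφ hψ
  have i1 : Integrable (fun x => |f x - a x| * |diverg ψ x|) := by
    refine ((hf.int_mul cψ.int_div).sub (ha.int_mul cψ.int_div)).norm.congr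
      (Eventually.of_forall fun x => ?_)
    simp only [Pi.sub_apply]
    rw [← sub_mul, norm_mul, Real.norm_eq_abs, Real.norm_eq_abs]
  have i2 := ha.int_mul cψ.int_div
  have i3 := (hW.min hf).int_mul cψ.int_div
  have h3 : (∫ x, a x * diverg ψ x) ≤
      (∫ x, min (W x) (f x) * diverg ψ x) + ∫ x, |f x - a x| * |diverg ψ x| := by
    rw [← integral_add i3 i1]
    refine integral_mono i2 (i3.add i1) fun x => ?_
    have hd : |a x - min (W x) (f x)| ≤ |f x - a x| := by
      have := haW x
      rcases le_total (W x) (f x) with hh | hh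
      · rw [min_eq_left hh, abs_of_nonpos (by linarith), abs_of_nonneg (by linarith)]
        linarith
      · rw [min_eq_right hh, abs_sub_comm]
    have : (a x - min (W x) (f x)) * diverg ψ x ≤ |f x - a x| * |diverg ψ x| := by
      refine (le_abs_self _).trans ?_
      rw [abs_mul]
      exact mul_le_mul_of_nonneg_right hd (abs_nonneg _)
    simp only [Pi.add_apply]
    linarith
  linarith


/-! ### Final assembly -/

theorem ind_integral {A : Set (Euc N)} (hmA : NullMeasurableSet A volume) (g : Euc N → ℝ) :
    ∫ x in A, g x = ∫ x, A.indicator 1 x * g x := by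
  rw [← integral_indicator₀ hmA]
  refine integral_congr_ae (Eventually.of_forall fun x => ?_)
  by_cases h : x ∈ A <;> simp [h]

theorem adm_ind {A : Set (Euc N)} (hmA : NullMeasurableSet A volume) :
    Adm (A.indicator (1 : Euc N → ℝ)) := by
  refine ⟨(aestronglyMeasurable_const (b := (1 : ℝ))).indicator₀ hmA, fun x => ?_, fun x => ?_⟩
  · exact indicator_nonneg (fun _ _ => zero_le_one) x
  · by_cases h : x ∈ A <;> simp [h]

theorem vb_perimeter {A Ω : Set (Euc N)} (hmA : NullMeasurableSet A volume)
    (hper : perimeter A Ω < ⊤) : VB Ω (A.indicator 1) (perimeter A Ω).toReal := by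
  intro φ hφ
  rw [← ind_integral hmA]
  have h : ENNReal.ofReal (∫ x in A, diverg φ x) ≤ perimeter A Ω :=
    le_iSup₂ (f := fun φ (_ : φ ∈ TestVF Ω) => ENNReal.ofReal (∫ x in A, diverg φ x)) φ hφ
  exact (ENNReal.ofReal_le_iff_le_toReal hper.ne).1 h

theorem exists_near {A Ω : Set (Euc N)} (hmA : NullMeasurableSet A volume)
    (hper : perimeter A Ω < ⊤) {η : ℝ} (hη : 0 < η) :
    ∃ ψ ∈ TestVF Ω, (perimeter A Ω).toReal - η ≤ ∫ x, A.indicator 1 x * diverg ψ x := by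
  by_contra! hn
  have h0 := hn (fun _ => 0) (testVF_zero Ω)
  have h00 : (∫ x, A.indicator 1 x * diverg (fun _ : Euc N => (0 : Euc N)) x) = 0 := by
    simp [diverg_zero]
  rw [h00] at h0
  have : perimeter A Ω ≤ ENNReal.ofReal ((perimeter A Ω).toReal - η) := by
    refine iSup₂_le fun φ hφ => ?_
    rw [ind_integral hmA]
    exact ENNReal.ofReal_le_ofReal (hn φ hφ).le
  have h2 := ENNReal.toReal_mono ENNReal.ofReal_ne_top this
  rw [ENNReal.toReal_ofReal h0.le] at h2
  linarith

theorem perimeter_le {A Ω : Set (Euc N)} (hmA : NullMeasurableSet A volume) {c : ℝ}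
    (h : VB Ω (A.indicator 1) c) : perimeter A Ω ≤ ENNReal.ofReal c := by
  refine iSup₂_le fun φ hφ => ?_
  rw [ind_integral hmA]
  exact ENNReal.ofReal_le_ofReal (h φ hφ)

theorem exists_cutoff {K Ω : Set (Euc N)} (hK : IsCompact K) (hΩ : IsOpen Ω) (h : K ⊆ Ω) :
    ∃ ζ : Euc N → ℝ, ContDiff ℝ 1 ζ ∧ Adm ζ ∧ HasCompactSupport ζ ∧ tsupport ζ ⊆ Ω ∧
      ∀ x ∈ K, ζ x = 1 := by
  obtain ⟨L, hL, hKL, hLΩ⟩ := exists_compact_between hK hΩ h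
  obtain ⟨f, hf0, hf1, hf⟩ := exists_contMDiffMap_zero_one_of_isClosed
    (modelWithCornersSelf ℝ (Euc N)) (n := 1) (s := (interior L)ᶜ) (t := K)
    isOpen_interior.isClosed_compl hK.isClosed
    (disjoint_left.2 fun x hx hxK => hx (hKL hxK))
  have hc : ContDiff ℝ 1 (f : Euc N → ℝ) := f.contMDiff.contDiff
  have hs : tsupport (f : Euc N → ℝ) ⊆ L := by
    refine closure_minimal (fun x hx => ?_) hL.isClosed
    by_contra hxL
    exact hx (hf0 (fun hi => hxL (interior_subset hi)))
  refine ⟨f, hc, ⟨hc.continuous.aestronglyMeasurable, fun x => (hf x).1, fun x => (hf x).2⟩,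
    hL.of_isClosed_subset (isClosed_tsupport _) hs, hs.trans hLΩ, fun x hx => hf1 hx⟩

theorem exists_cutoffs {Ω : Set (Euc N)} (hΩ : IsOpen Ω) :
    ∃ ζ : ℕ → Euc N → ℝ, (∀ n, ContDiff ℝ 1 (ζ n) ∧ Adm (ζ n) ∧ HasCompactSupport (ζ n) ∧
      tsupport (ζ n) ⊆ Ω) ∧ ∀ x ∈ Ω, ∀ᶠ n in atTop, ζ n x = 1 := by
  obtain ⟨F, hFc, hFs, hFu, hFm⟩ := hΩ.exists_iUnion_isClosed
  have hK : ∀ n : ℕ, IsCompact (F n ∩ closedBall (0 : Euc N) n) := fun n =>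
    (isCompact_closedBall _ _).inter_left (hFc n)
  choose ζ h1 h2 h3 h4 h5 using fun n : ℕ =>
    exists_cutoff (hK n) hΩ (inter_subset_left.trans (hFs n))
  refine ⟨ζ, fun n => ⟨h1 n, h2 n, h3 n, h4 n⟩, fun x hx => ?_⟩
  rw [← hFu] at hx
  obtain ⟨m, hm⟩ := mem_iUnion.1 hx
  obtain ⟨k, hk⟩ := exists_nat_ge ‖x‖
  filter_upwards [eventually_ge_atTop m, eventually_ge_atTop k] with n hn1 hn2
  refine h5 n x ⟨hFm hn1 hm, ?_⟩
  rw [mem_closedBall, dist_zero_right]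
  exact hk.trans (by exact_mod_cast hn2)

theorem ae_density {A : Set (Euc N)} : ∀ᵐ x, x ∈ A → HasDensity A x 1 := by
  have h := Besicovitch.ae_tendsto_measure_inter_div (volume : Measure (Euc N)) A
  have h' := ae_imp_of_ae_restrict h
  filter_upwards [h'] with x hx hxA
  have h1 := hx hxA
  unfold HasDensity
  rw [ENNReal.ofReal_one]
  refine h1.congr' ?_
  filter_upwards [self_mem_nhdsWithin] with r (hr : 0 < r)
  have hae : (closedBall x r : Set (Euc N)) =ᵐ[volume] ball x r := by
    rw [← ball_union_sphere]
    refine union_ae_eq_left_of_ae_eq_empty ?_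
    exact ae_eq_empty.2 (Measure.addHaar_sphere_of_ne_zero _ _ hr.ne')
  rw [measure_congr hae, measure_congr ((ae_eq_refl A).inter hae)]

/-- The sequence of running maxima. -/
def runMax (a : Euc N → ℝ) (f : ℕ → Euc N → ℝ) : ℕ → Euc N → ℝ
  | 0 => a
  | n + 1 => fun x => max (runMax a f n x) (f n x)

theorem runMax_adm {a : Euc N → ℝ} {f : ℕ → Euc N → ℝ} (ha : Adm a) (hf : ∀ n, Adm (f n)) (n : ℕ) :
    Adm (runMax a f n) := by
  induction n with
  | zero => exact ha
  | succ n ih => exact ih.max (hf n)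

theorem runMax_mono (a : Euc N → ℝ) (f : ℕ → Euc N → ℝ) (x : Euc N) :
    Monotone fun n => runMax a f n x :=
  monotone_nat_of_le_succ fun _ => le_max_left _ _

theorem runMax_lt {a : Euc N → ℝ} {f : ℕ → Euc N → ℝ} {x : Euc N} {t : ℝ} {n : ℕ}
    (h : t < runMax a f n x) : t < a x ∨ ∃ j, t < f j x := by
  induction n with
  | zero => exact Or.inl h
  | succ n ih =>
    rcases lt_max_iff.1 h with h | h
    · exact ih h
    · exact Or.inr ⟨n, h⟩

theorem runMax_vb {Ω : Set (Euc N)} (hΩ : IsOpen Ω) {a : Euc N → ℝ} {f : ℕ → Euc N → ℝ}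
    (ha : Adm a) (hf : ∀ n, Adm (f n)) {P : ℝ} (hP : VB Ω a P) {η : ℕ → ℝ}
    (hfP : ∀ n, VB Ω (f n) (P + η n)) {ψ : ℕ → Euc N → Euc N} (hψ : ∀ n, ψ n ∈ TestVF Ω)
    (h1 : ∀ n, P - η n ≤ ∫ x, a x * diverg (ψ n) x)
    (h2 : ∀ n, ∫ x, |f n x - a x| * |diverg (ψ n) x| ≤ η n) (n : ℕ) :
    VB Ω (runMax a f n) (P + 3 * ∑ j ∈ Finset.range n, η j) := by
  induction n with
  | zero =>
    simp only [Finset.range_zero, Finset.sum_empty, mul_zero, add_zero]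
    exact hP
  | succ n ih =>
    have := glue hΩ ha (runMax_adm ha hf n) (hf n) (fun x => runMax_mono a f x (Nat.zero_le n))
      ih (hfP n) (hψ n) (h1 n) (h2 n)
    rw [Finset.sum_range_succ, mul_add, ← add_assoc]
    exact this

theorem geom_sum_le (n : ℕ) : ∑ j ∈ Finset.range n, ((1 : ℝ) / 2) ^ (j + 1) ≤ 1 := by
  have : ∑ j ∈ Finset.range n, ((1 : ℝ) / 2) ^ (j + 1) = 1 - (1 / 2) ^ n := by
    induction n with
    | zero => simp
    | succ n ih => rw [Finset.sum_range_succ, ih]; ring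
  rw [this]
  have : (0 : ℝ) ≤ (1 / 2) ^ n := by positivity
  linarith

theorem exists_step {Ω A : Set (Euc N)} (hΩ : IsOpen Ω) (hmA : NullMeasurableSet A volume)
    (hper : perimeter A Ω < ⊤) {ζ : Euc N → ℝ} (hζ : ContDiff ℝ 1 ζ) (hζa : Adm ζ)
    (hζc : HasCompactSupport ζ) (hζs : tsupport ζ ⊆ Ω) {η δ : ℝ} (hη : 0 < η) (hδ : 0 < δ) (m : ℕ) :
    ∃ n, m ≤ n ∧ ∃ ψ ∈ TestVF Ω,
      VB Ω (fun x => ζ x * mol n (A.indicator 1) x + (1 - ζ x) * A.indicator 1 x)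
        ((perimeter A Ω).toReal + η) ∧
      (perimeter A Ω).toReal - η ≤ ∫ x, A.indicator 1 x * diverg ψ x ∧
      ∫ x, |(ζ x * mol n (A.indicator 1) x + (1 - ζ x) * A.indicator 1 x) - A.indicator 1 x| *
        |diverg ψ x| ≤ η ∧
      Integrable (fun x => |mol n (A.indicator 1) x - A.indicator 1 x| * |ζ x|) ∧
      ∫ x, |mol n (A.indicator 1) x - A.indicator 1 x| * |ζ x| ≤ δ := by
  have ha := adm_ind hmA
  obtain ⟨ψ, hψ, h1⟩ := exists_near hmA hper hη
  obtain ⟨C, hC0, hC⟩ := (TestVF.cf hψ).bdd_div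
  have hC1 : 0 < C + 1 := by linarith
  have hpos : 0 < min (min η δ) (η / (C + 1)) := lt_min (lt_min hη hδ) (by positivity)
  obtain ⟨n, ⟨hn1, hn2⟩, hn3⟩ := ((approx hΩ ha (vb_perimeter hmA hper) hζ hζa hζc hζs hpos).and
    (eventually_ge_atTop m)).exists
  have iζ : Integrable ζ := hζ.continuous.integrable_of_hasCompactSupport hζc
  have i1 : Integrable (fun x => |mol n (A.indicator 1) x - A.indicator 1 x| * |ζ x|) := by
    refine (((mol_adm n ha).int_mul iζ).sub (ha.int_mul iζ)).norm.congr
      (Eventually.of_forall fun x => ?_)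
    simp only [Pi.sub_apply]
    rw [← sub_mul, norm_mul, Real.norm_eq_abs, Real.norm_eq_abs]
  have e1 : min (min η δ) (η / (C + 1)) ≤ η := (min_le_left _ _).trans (min_le_left _ _)
  have e2 : min (min η δ) (η / (C + 1)) ≤ δ := (min_le_left _ _).trans (min_le_right _ _)
  refine ⟨n, hn3, ψ, hψ, fun φ hφ => (hn1 φ hφ).trans (by linarith), h1, ?_, i1, hn2.trans e2⟩
  have key : ∀ x, |(ζ x * mol n (A.indicator 1) x + (1 - ζ x) * A.indicator 1 x)
      - A.indicator 1 x| * |diverg ψ x| ≤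
      (C + 1) * (|mol n (A.indicator 1) x - A.indicator 1 x| * |ζ x|) := fun x => by
    have : (ζ x * mol n (A.indicator 1) x + (1 - ζ x) * A.indicator 1 x) - A.indicator 1 x
        = (mol n (A.indicator 1) x - A.indicator 1 x) * ζ x := by ring
    rw [this, abs_mul, mul_comm]
    exact mul_le_mul_of_nonneg_right ((hC x).trans (by linarith)) (by positivity)
  calc _ ≤ ∫ x, (C + 1) * (|mol n (A.indicator 1) x - A.indicator 1 x| * |ζ x|) :=
        integral_mono_of_nonneg (Eventually.of_forall fun x => by positivity)
          (i1.const_mul _) (Eventually.of_forall key)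
    _ = (C + 1) * ∫ x, |mol n (A.indicator 1) x - A.indicator 1 x| * |ζ x| :=
        integral_const_mul _ _
    _ ≤ (C + 1) * (η / (C + 1)) :=
        mul_le_mul_of_nonneg_left (hn2.trans (min_le_right _ _)) hC1.le
    _ = η := by field_simp

/-- if `A ⊆ Ω` is a measurable set of finite perimeter in the open set `Ω`,
then for every `ε > 0` there are `Z ⊆ Ω` with `H^{N-1}(Z) < ε` and an open `U ⊆ Ω` with
`A^{(1)} ⊆ U ∪ Z`, `λ^N(U \ A) < ε` and `P(U, Ω) < P(A, Ω) + ε`. -/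
theorem statement15 {N : ℕ} (Ω : Set (Euc N)) (hΩ : IsOpen Ω)
    (A : Set (Euc N)) (hA : A ⊆ Ω) (hmA : NullMeasurableSet A volume)
    (hper : perimeter A Ω < ⊤) (ε : ℝ) (hε : 0 < ε) :
    ∃ (Z U : Set (Euc N)), Z ⊆ Ω ∧
      (μH[(N : ℝ) - 1] : Measure (Euc N)) Z < ENNReal.ofReal ε ∧
      IsOpen U ∧ U ⊆ Ω ∧ densityOne A Ω ⊆ U ∪ Z ∧
      volume (U \ A) < ENNReal.ofReal ε ∧
      perimeter U Ω < perimeter A Ω + ENNReal.ofReal ε := by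
  have ha := adm_ind hmA
  have hPV := vb_perimeter hmA hper
  have hP0 : 0 ≤ (perimeter A Ω).toReal := ENNReal.toReal_nonneg
  obtain ⟨ζ, hζ, hζ1⟩ := exists_cutoffs hΩ
  set P := (perimeter A Ω).toReal with hPdef
  obtain ⟨s, hsdef⟩ : ∃ s : ℝ, s = ε / (8 * (P + ε)) := ⟨_, rfl⟩
  have hPe : 0 < P + ε := by linarith
  have hs0 : 0 < s := by rw [hsdef]; positivity
  have hs8 : s * (P + ε) = ε / 8 := by rw [hsdef]; field_simp
  have hs1 : s < 1 := by
    rw [hsdef, div_lt_one (by positivity)]; linarith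
  have hstep := fun j : ℕ => exists_step hΩ hmA hper (hζ j).1 (hζ j).2.1 (hζ j).2.2.1 (hζ j).2.2.2
    (η := (ε / 12) * (1 / 2) ^ (j + 1)) (δ := s * (ε / 2 * (1 / 2) ^ (j + 1)))
    (by positivity) (by positivity) j
  choose n hn ψ hψ hv h1 h2 hi hd using hstep
  obtain ⟨a, hadef⟩ : ∃ a : Euc N → ℝ, a = A.indicator 1 := ⟨_, rfl⟩
  rw [← hadef] at ha hPV
  simp only [← hadef] at hv h1 h2 hi hd
  obtain ⟨f, hfdef⟩ : ∃ f : ℕ → Euc N → ℝ,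
      f = fun j x => ζ j x * mol (n j) a x + (1 - ζ j x) * a x := ⟨_, rfl⟩
  have hfx : ∀ j x, f j x = ζ j x * mol (n j) a x + (1 - ζ j x) * a x := fun j x => by rw [hfdef]
  have hfa : ∀ j, Adm (f j) := fun j => by
    rw [hfdef]; exact Adm.comb (mol_adm (n j) ha) ha (hζ j).2.1
  have hWa := runMax_adm ha hfa
  have hWv : ∀ k, VB Ω (runMax a f k) (P + ε / 4) := fun k φ hφ => by
    have := runMax_vb hΩ ha hfa hPV (f := f) (ψ := ψ)
      (η := fun j => (ε / 12) * (1 / 2) ^ (j + 1)) (fun j => by rw [hfdef]; exact hv j) hψ h1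
      (fun j => by rw [hfdef]; exact h2 j) k φ hφ
    refine this.trans ?_
    rw [← Finset.mul_sum]
    have := geom_sum_le k
    nlinarith
  have hbdd : ∀ x, BddAbove (range fun k => runMax a f k x) := fun x =>
    ⟨1, by rintro _ ⟨k, rfl⟩; exact (hWa k).le_one x⟩
  obtain ⟨W, hWdef⟩ : ∃ W : Euc N → ℝ, W = fun x => ⨆ k, runMax a f k x := ⟨_, rfl⟩
  have hWlim : ∀ x, Tendsto (fun k => runMax a f k x) atTop (𝓝 (W x)) := fun x => by
    rw [hWdef]; exact tendsto_atTop_ciSup (runMax_mono a f x) (hbdd x)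
  have hkW : ∀ k x, runMax a f k x ≤ W x := fun k x => by
    rw [hWdef]; exact le_ciSup (hbdd x) k
  have hWadm : Adm W := by
    refine ⟨aestronglyMeasurable_of_tendsto_ae atTop (fun k => (hWa k).meas)
      (Eventually.of_forall hWlim), fun x => (ha.nonneg x).trans (hkW 0 x), fun x => ?_⟩
    exact le_of_tendsto' (hWlim x) fun k => (hWa k).le_one x
  have hWV : VB Ω W (P + ε / 4) := VB.limit hWa hWv (Eventually.of_forall hWlim)
  obtain ⟨t, hst, ht1, htV⟩ := coarea hΩ hWadm hWV hs0 hs1 (c := P + ε / 2) (by nlinarith)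
  have ht0 : 0 < t := hs0.trans_le hst
  have hUo : IsOpen (⋃ j, {x | t < ζ j x * mol (n j) a x}) :=
    isOpen_iUnion fun j => isOpen_lt continuous_const
      ((hζ j).1.continuous.mul (mol_contDiff (n j) ha (k := 0)).continuous)
  have hdens : densityOne A Ω ⊆ ⋃ j, {x | t < ζ j x * mol (n j) a x} := by
    rintro x ⟨hxΩ, hx⟩
    have hm := mol_density (hadef ▸ ha) hmA hx
    rw [← hadef] at hm
    have hn' : Tendsto n atTop atTop := tendsto_atTop_mono hn tendsto_id
    obtain ⟨j, hj1, hj2⟩ := (((hm.comp hn').eventually_const_lt ht1).and (hζ1 x hxΩ)).exists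
    refine mem_iUnion.2 ⟨j, ?_⟩
    rw [mem_setOf_eq, hj2, one_mul]
    exact hj1
  have haA : ∀ x, x ∉ A → a x = 0 := fun x hx => by rw [hadef]; simp [hx]
  have haA1 : ∀ x, x ∈ A → a x = 1 := fun x hx => by rw [hadef]; simp [hx]
  refine ⟨∅, ⋃ j, {x | t < ζ j x * mol (n j) a x}, empty_subset _, ?_, hUo, ?_, ?_, ?_, ?_⟩
  · rw [measure_empty]; exact ENNReal.ofReal_pos.2 hε
  · refine iUnion_subset fun j x hx => (hζ j).2.2.2 (subset_tsupport _ ?_)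
    intro h0
    rw [mem_setOf_eq, h0, zero_mul] at hx
    linarith
  · rw [union_empty]; exact hdens
  · have hsub : (⋃ j, {x | t < ζ j x * mol (n j) a x}) \ A ⊆
        ⋃ j, {x | s ≤ |mol (n j) a x - a x| * |ζ j x|} := by
      rintro x ⟨hx, hxA⟩
      obtain ⟨j, hj⟩ := mem_iUnion.1 hx
      refine mem_iUnion.2 ⟨j, ?_⟩
      rw [mem_setOf_eq] at hj ⊢
      rw [haA x hxA, sub_zero, ← abs_mul, mul_comm]
      exact hst.trans (hj.le.trans (le_abs_self _))
    have hM : ∀ j, volume {x | s ≤ |mol (n j) a x - a x| * |ζ j x|} ≤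
        ENNReal.ofReal (ε / 2) * (2⁻¹ : ℝ≥0∞) ^ (j + 1) := fun j => by
      have h3 := mul_meas_ge_le_integral_of_nonneg
        (Eventually.of_forall fun x => by positivity) (hi j) s
      have h4 : volume.real {x | s ≤ |mol (n j) a x - a x| * |ζ j x|} ≤
          ε / 2 * (1 / 2) ^ (j + 1) := le_of_mul_le_mul_left (h3.trans (hd j)) hs0
      have hfin : volume {x | s ≤ |mol (n j) a x - a x| * |ζ j x|} ≠ ⊤ :=
        ((hi j).measure_ge_lt_top hs0).ne
      rw [measureReal_def] at h4
      have h5 := (ENNReal.le_ofReal_iff_toReal_le hfin (by positivity)).2 h4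
      refine h5.trans (le_of_eq ?_)
      rw [ENNReal.ofReal_mul (by positivity), ENNReal.ofReal_pow (by positivity), one_div,
        ENNReal.ofReal_inv_of_pos two_pos]
      simp
    calc _ ≤ volume (⋃ j, {x | s ≤ |mol (n j) a x - a x| * |ζ j x|}) := measure_mono hsub
      _ ≤ ∑' j, volume {x | s ≤ |mol (n j) a x - a x| * |ζ j x|} := measure_iUnion_le _
      _ ≤ ∑' j : ℕ, ENNReal.ofReal (ε / 2) * (2⁻¹ : ℝ≥0∞) ^ (j + 1) := ENNReal.tsum_le_tsum hM
      _ = ENNReal.ofReal (ε / 2) := by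
        rw [ENNReal.tsum_mul_left, ENNReal.tsum_geometric_add_one, ENNReal.one_sub_inv_two,
          inv_inv, ENNReal.inv_mul_cancel (by norm_num) (by norm_num), mul_one]
      _ < ENNReal.ofReal ε := (ENNReal.ofReal_lt_ofReal_iff hε).2 (by linarith)
  · have hae : ({x | t < W x} : Set (Euc N)) =ᵐ[volume]
        ⋃ j, {x | t < ζ j x * mol (n j) a x} := by
      filter_upwards [ae_density (A := A)] with x hx
      refine propext ⟨fun h => ?_, fun h => ?_⟩
      · by_cases hxA : x ∈ A
        · exact hdens ⟨hA hxA, hx hxA⟩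
        · obtain ⟨k, hk⟩ := ((hWlim x).eventually_const_lt h).exists
          rcases runMax_lt hk with h | ⟨j, h⟩
          · rw [haA x hxA] at h; linarith
          · rw [hfx, haA x hxA, mul_zero, add_zero] at h
            exact mem_iUnion.2 ⟨j, h⟩
      · obtain ⟨j, hj⟩ := mem_iUnion.1 h
        have h5 : f j x ≤ W x := (le_max_right _ _).trans (hkW (j + 1) x)
        have h6 : ζ j x * mol (n j) a x ≤ f j x := by
          rw [hfx]
          have := mul_nonneg (sub_nonneg.2 ((hζ j).2.1.le_one x)) (ha.nonneg x)
          linarith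
        exact hj.trans_le (h6.trans h5)
    have hUV : VB Ω ((⋃ j, {x | t < ζ j x * mol (n j) a x}).indicator 1) (P + ε / 2) :=
      fun φ hφ => by
        refine le_trans (le_of_eq ?_) (htV φ hφ)
        refine integral_congr_ae ?_
        filter_upwards [indicator_ae_eq_of_ae_eq_set (f := (1 : Euc N → ℝ)) hae] with x hx
        rw [hx]
    calc _ ≤ ENNReal.ofReal (P + ε / 2) := perimeter_le hUo.measurableSet.nullMeasurableSet hUV
      _ < ENNReal.ofReal (P + ε) := (ENNReal.ofReal_lt_ofReal_iff hPe).2 (by linarith)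
      _ = perimeter A Ω + ENNReal.ofReal ε := by
        rw [ENNReal.ofReal_add hP0 hε.le, hPdef, ENNReal.ofReal_toReal hper.ne]
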